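/- Properties of the gauge generator g_t: Let T > 0, R > 1, let r, s : (−T,T) → ℝ be continuous with r + s = 1/2 and r·s = t, and A_t the Delaunay residue. Let c₁₁, c₁₂, c₂₁ : (−T,T) × D_R → ℂ be continuous and holomorphic in λ, and C_t(λ) = [[c₁₁(t,λ), λ⁻¹·c₁₂(t,λ)], [c₂₁(t,λ), −c₁₁(t,λ)]]. Set p_t = (s(t)·c₁₂(t,0) + r(t)·c₂₁(t,0))/2, and for t ≠ 0 and λ ∈ D_R∖{0,1} (where 1 − 4μ_t(λ)² = −4t·λ⁻¹·(λ−1)² ≠ 0) define P_{t,1}(λ) = t·( C_t(λ) − (1 − 4μ_t(λ)²)⁻¹·(I − 2A_t(λ))·(A_t(λ)·C_t(λ) − C_t(λ)·A_t(λ)) ) and g_t(λ) = p_t·A_t(λ) − P_{t,1}(λ). Then: (1) for every t ≠ 0, the map λ ↦ g_t(λ) extends holomorphically across λ = 0, and the bottom-left entry of its value at λ = 0 is zero (i.e. g_t(0) is upper triangular); (2) if moreover r(t) ≥ s(t) for all t, the c_{ij} are continuous in (t,λ), and the function c(λ) := −λ·( c₁₁(0,λ) + c₁₂(0,λ)/2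 ) + c₂₁(0,λ)/2 vanishes identically on D_R, then for every fixed λ ∈ D_R∖{0,1} one has g_t(λ) → 0 as t → 0 with t ≠ 0. -/

import Mathlib

open Matrix Complex

attribute [local instance] Matrix.normedAddCommGroup Matrix.normedSpace

/-- The Delaunay residue `A_t(λ) = [[0, rλ⁻¹ + s], [rλ + s, 0]]`. -/
noncomputable def delaunayResidue (r s : ℝ) (lam : ℂ) : Matrix (Fin 2) (Fin 2) ℂ :=
  !![0, (r : ℂ) * lam⁻¹ + (s : ℂ); (r : ℂ) * lam + (s : ℂ), 0]

/-- The perturbation matrix `C_t(λ)`. -/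
noncomputable def Cmat (c11 c12 c21 : ℝ → ℂ → ℂ) (t : ℝ) (lam : ℂ) :
    Matrix (Fin 2) (Fin 2) ℂ :=
  !![c11 t lam, lam⁻¹ * c12 t lam; c21 t lam, -c11 t lam]

/-- The quantity `p_t = (s(t)·c₁₂(t,0) + r(t)·c₂₁(t,0))/2`. -/
noncomputable def pquant (r s : ℝ → ℝ) (c12 c21 : ℝ → ℂ → ℂ) (t : ℝ) : ℂ :=
  ((s t : ℂ) * c12 t 0 + (r t : ℂ) * c21 t 0) / 2

/-- The first Fröbenius coefficient `P_{t,1}(λ) = t·L_{t,1}⁻¹(C_t(λ))`, via the explicit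
inverse, using `1 − 4μ_t(λ)² = −4tλ⁻¹(λ−1)²`. -/
noncomputable def Pt1 (r s : ℝ → ℝ) (c11 c12 c21 : ℝ → ℂ → ℂ) (t : ℝ) (lam : ℂ) :
    Matrix (Fin 2) (Fin 2) ℂ :=
  (t : ℂ) • (Cmat c11 c12 c21 t lam -
    (-(4 * (t : ℂ) * lam⁻¹ * (lam - 1) ^ 2))⁻¹ •
      ((1 - 2 • delaunayResidue (r t) (s t) lam) *
        (delaunayResidue (r t) (s t) lam * Cmat c11 c12 c21 t lam -
          Cmat c11 c12 c21 t lam * delaunayResidue (r t) (s t) lam)))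

/-- The gauge generator `g_t(λ) = p_t·A_t(λ) − P_{t,1}(λ)`. -/
noncomputable def gaugeGen (r s : ℝ → ℝ) (c11 c12 c21 : ℝ → ℂ → ℂ) (t : ℝ) (lam : ℂ) :
    Matrix (Fin 2) (Fin 2) ℂ :=
  pquant r s c12 c21 t • delaunayResidue (r t) (s t) lam - Pt1 r s c11 c12 c21 t lam

/-- `λ (d - x)`, where `x`, `y`, `z` are the values of `c₁₁`, `c₁₂`, `c₂₁` and `d` is the
top-left entry of `[A, C]`. -/
def commutatorNum (r s lam x y z : ℂ) : ℂ :=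
  (r + s * lam) * z - (r * lam + s) * y - lam * x

/-- `λ` times the top-right entry of `p A - P`. -/
noncomputable def gaugeNum (p r s lam x y z : ℂ) : ℂ :=
  p * (r + s * lam) - r * s * y
    - (r + s * lam) * commutatorNum r s lam x y z / (2 * (lam - 1) ^ 2)

/-- The bottom-left entry of `p A - P`. -/
noncomputable def gaugeLower (p r s lam x y z : ℂ) : ℂ :=
  p * (r * lam + s) - r * s * z
    + (r * lam + s) * commutatorNum r s lam x y z / (2 * (lam - 1) ^ 2)

/-- The bottom-right entry of `p A - P`. -/
noncomputable def gaugeDiag (r s lam x y z : ℂ) : ℂ :=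
  commutatorNum r s lam x y z / (4 * (lam - 1) ^ 2)

theorem gaugeGen_eq (r s : ℝ → ℝ) (c11 c12 c21 : ℝ → ℂ → ℂ) {t : ℝ} {lam : ℂ}
    (ht : t ≠ 0) (h0 : lam ≠ 0) (h1 : lam ≠ 1) (hsum : r t + s t = 1 / 2)
    (hprod : r t * s t = t) :
    gaugeGen r s c11 c12 c21 t lam =
      !![-gaugeDiag (r t) (s t) lam (c11 t lam) (c12 t lam) (c21 t lam),
        gaugeNum (pquant r s c12 c21 t) (r t) (s t) lam (c11 t lam) (c12 t lam) (c21 t lam) / lam;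
        gaugeLower (pquant r s c12 c21 t) (r t) (s t) lam (c11 t lam) (c12 t lam) (c21 t lam),
        gaugeDiag (r t) (s t) lam (c11 t lam) (c12 t lam) (c21 t lam)] := by
  have hD : lam - 1 ≠ 0 := sub_ne_zero.mpr h1
  have htC : (t : ℂ) ≠ 0 := by exact_mod_cast ht
  have hst : (s t : ℂ) = 1 / 2 - r t := by
    rw [eq_sub_of_add_eq' hsum]
    push_cast
    ring
  have hscal (M N : Matrix (Fin 2) (Fin 2) ℂ) :
      (t : ℂ) • (M - (-(4 * (t : ℂ) * lam⁻¹ * (lam - 1) ^ 2))⁻¹ • N) =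
        (t : ℂ) • M + (lam / (4 * (lam - 1) ^ 2)) • N := by
    rw [smul_sub, smul_smul, sub_eq_add_neg, ← neg_smul]
    congr 2
    field_simp
  have hrst : (t : ℂ) = r t * s t := by exact_mod_cast hprod.symm
  unfold gaugeGen Pt1
  rw [hscal, hrst, hst]
  generalize pquant r s c12 c21 t = p
  ext i j
  fin_cases i <;> fin_cases j <;>
    simp [delaunayResidue, Cmat, gaugeDiag, gaugeNum, gaugeLower, commutatorNum,
      Matrix.mul_apply, Fin.sum_univ_two, hst] <;>
    field_simp <;> ring

theorem gaugeNum_zero (r s x y z : ℂ) :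
    gaugeNum ((s * y + r * z) / 2) r s 0 x y z = 0 := by
  simp only [gaugeNum, commutatorNum]
  ring

theorem gaugeLower_zero (r s x y z : ℂ) :
    gaugeLower ((s * y + r * z) / 2) r s 0 x y z = 0 := by
  simp only [gaugeLower, commutatorNum]
  ring

/-- Properties of the gauge generator `g_t`. -/
theorem gauge_generator_properties
    (T R : ℝ) (hT : 0 < T) (hR : 1 < R)
    (r s : ℝ → ℝ)
    (hrcont : ContinuousOn r (Set.Ioo (-T) T)) (hscont : ContinuousOn s (Set.Ioo (-T) T))
    (hrs : ∀ t ∈ Set.Ioo (-T) T, r t + s t = 1 / 2 ∧ r t * s t = t)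
    (c11 c12 c21 : ℝ → ℂ → ℂ)
    (hccont : ∀ c ∈ ({c11, c12, c21} : Set (ℝ → ℂ → ℂ)),
      ContinuousOn (fun p : ℝ × ℂ => c p.1 p.2) (Set.Ioo (-T) T ×ˢ Metric.ball (0 : ℂ) R))
    (hchol : ∀ c ∈ ({c11, c12, c21} : Set (ℝ → ℂ → ℂ)), ∀ t ∈ Set.Ioo (-T) T,
      DifferentiableOn ℂ (c t) (Metric.ball (0 : ℂ) R)) :
    (∀ t ∈ Set.Ioo (-T) T, t ≠ 0 →
      ∃ G : ℂ → Matrix (Fin 2) (Fin 2) ℂ,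
        DifferentiableOn ℂ G (Metric.ball (0 : ℂ) R \ {1}) ∧
        (∀ lam ∈ Metric.ball (0 : ℂ) R \ ({0, 1} : Set ℂ),
          G lam = gaugeGen r s c11 c12 c21 t lam) ∧
        (G 0) 1 0 = 0) ∧
    ((∀ t ∈ Set.Ioo (-T) T, s t ≤ r t) →
      (∀ lam ∈ Metric.ball (0 : ℂ) R,
        -lam * (c11 0 lam + c12 0 lam / 2) + c21 0 lam / 2 = 0) →
      ∀ lam ∈ Metric.ball (0 : ℂ) R \ ({0, 1} : Set ℂ),
        Filter.Tendsto (fun t => gaugeGen r s c11 c12 c21 t lam)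
          (nhdsWithin 0 {t : ℝ | t ≠ 0}) (nhds 0)) := by
  have hx := hchol c11 (by simp)
  have hy := hchol c12 (by simp)
  have hz := hchol c21 (by simp)
  refine ⟨fun t ht ht0 => ?_, fun hsr hc lam hlam => ?_⟩
  · have hsub : Metric.ball (0 : ℂ) R \ {1} ⊆ Metric.ball 0 R := Set.sdiff_subset
    have hx := (hx t ht).mono hsub
    have hy := (hy t ht).mono hsub
    have hz := (hz t ht).mono hsub
    have hD : ∀ lam ∈ Metric.ball (0 : ℂ) R \ {1}, lam - 1 ≠ 0 :=
      fun lam h => sub_ne_zero.mpr h.2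
    have hD2 : ∀ lam ∈ Metric.ball (0 : ℂ) R \ {1}, (2 : ℂ) * (lam - 1) ^ 2 ≠ 0 :=
      fun lam h => mul_ne_zero two_ne_zero (pow_ne_zero 2 (hD lam h))
    have hD4 : ∀ lam ∈ Metric.ball (0 : ℂ) R \ {1}, (4 : ℂ) * (lam - 1) ^ 2 ≠ 0 :=
      fun lam h => mul_ne_zero (by norm_num) (pow_ne_zero 2 (hD lam h))
    set p := pquant r s c12 c21 t
    set N : ℂ → ℂ := fun lam =>
      gaugeNum p (r t) (s t) lam (c11 t lam) (c12 t lam) (c21 t lam) with hNdef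
    have hq : DifferentiableOn ℂ (fun lam => commutatorNum (r t) (s t) lam
        (c11 t lam) (c12 t lam) (c21 t lam)) (Metric.ball (0 : ℂ) R \ {1}) := by
      unfold commutatorNum
      fun_prop
    have hN : DifferentiableOn ℂ N (Metric.ball (0 : ℂ) R \ {1}) := by
      simp only [hNdef, gaugeNum]
      fun_prop (disch := assumption)
    have hL : DifferentiableOn ℂ (fun lam => gaugeLower p (r t) (s t) lam
        (c11 t lam) (c12 t lam) (c21 t lam)) (Metric.ball (0 : ℂ) R \ {1}) := by
      unfold gaugeLower
      fun_prop (disch := assumption)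
    have hQ : DifferentiableOn ℂ (fun lam => gaugeDiag (r t) (s t) lam
        (c11 t lam) (c12 t lam) (c21 t lam)) (Metric.ball (0 : ℂ) R \ {1}) := by
      unfold gaugeDiag
      fun_prop (disch := assumption)
    have hmem : Metric.ball (0 : ℂ) R \ {1} ∈ nhds (0 : ℂ) :=
      (Metric.isOpen_ball.sdiff isClosed_singleton).mem_nhds
        ⟨Metric.mem_ball_self (by linarith), by simp⟩
    have hN0 : N 0 = 0 := gaugeNum_zero _ _ _ _ _
    refine ⟨fun lam =>
      !![-gaugeDiag (r t) (s t) lam (c11 t lam) (c12 t lam) (c21 t lam), dslope N 0 lam;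
        gaugeLower p (r t) (s t) lam (c11 t lam) (c12 t lam) (c21 t lam),
        gaugeDiag (r t) (s t) lam (c11 t lam) (c12 t lam) (c21 t lam)], ?_, ?_, ?_⟩
    · refine differentiableOn_pi.mpr fun i => differentiableOn_pi.mpr fun j => ?_
      fin_cases i <;> fin_cases j
      exacts [hQ.neg, (Complex.differentiableOn_dslope hmem).mpr hN, hL, hQ]
    · rintro lam ⟨-, hlam⟩
      simp only [Set.mem_insert_iff, Set.mem_singleton_iff, not_or] at hlam
      beta_reduce
      rw [gaugeGen_eq r s c11 c12 c21 ht0 hlam.1 hlam.2 (hrs t ht).1 (hrs t ht).2,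
        dslope_of_ne _ hlam.1, slope_def_field, hN0, sub_zero, sub_zero]
    · exact gaugeLower_zero _ _ _ _ _
  · obtain ⟨hlamR, hlam⟩ := hlam
    simp only [Set.mem_insert_iff, Set.mem_singleton_iff, not_or] at hlam
    have hT0 : (0 : ℝ) ∈ Set.Ioo (-T) T := ⟨by linarith, hT⟩
    have hnhds : Set.Ioo (-T) T ∈ nhds (0 : ℝ) := Ioo_mem_nhds hT0.1 hT0.2
    have h0R : (0 : ℂ) ∈ Metric.ball (0 : ℂ) R := Metric.mem_ball_self (by linarith)
    have hs0 : s 0 = 0 := by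
      obtain ⟨h1, h2⟩ := hrs 0 hT0
      have h3 := hsr 0 hT0
      rcases mul_eq_zero.mp h2 with h | h <;> linarith
    have hr0 : r 0 = 1 / 2 := by linarith [(hrs 0 hT0).1]
    have hrc : ContinuousAt (fun t => (r t : ℂ)) 0 :=
      Complex.continuous_ofReal.continuousAt.comp (hrcont.continuousAt hnhds)
    have hsc : ContinuousAt (fun t => (s t : ℂ)) 0 :=
      Complex.continuous_ofReal.continuousAt.comp (hscont.continuousAt hnhds)
    have hcc : ∀ c ∈ ({c11, c12, c21} : Set (ℝ → ℂ → ℂ)), ∀ w ∈ Metric.ball (0 : ℂ) R,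
        ContinuousAt (fun t => c t w) 0 := by
      intro c hcmem w hw
      have h := (hccont c hcmem).continuousAt (x := ((0 : ℝ), w))
        (prod_mem_nhds hnhds (Metric.isOpen_ball.mem_nhds hw))
      exact ContinuousAt.comp (f := fun t : ℝ => (t, w)) h (by fun_prop)
    have hx := hcc c11 (by simp) lam hlamR
    have hy := hcc c12 (by simp) lam hlamR
    have hz := hcc c21 (by simp) lam hlamR
    have hy0 := hcc c12 (by simp) 0 h0R
    have hz0 := hcc c21 (by simp) 0 h0R
    have hpc : ContinuousAt (pquant r s c12 c21) 0 := by
      unfold pquant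
      fun_prop
    have hz00 : c21 0 0 = 0 := by simpa using hc 0 h0R
    have hp0 : pquant r s c12 c21 0 = 0 := by simp [pquant, hs0, hz00]
    have hq0 : commutatorNum (r 0) (s 0) lam (c11 0 lam) (c12 0 lam) (c21 0 lam) = 0 := by
      rw [hr0, hs0, ← hc lam hlamR, commutatorNum]
      push_cast
      ring
    have hqc : ContinuousAt (fun t => commutatorNum (r t) (s t) lam
        (c11 t lam) (c12 t lam) (c21 t lam)) 0 := by
      unfold commutatorNum
      fun_prop
    have hNc : ContinuousAt (fun t => gaugeNum (pquant r s c12 c21 t) (r t) (s t) lam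
        (c11 t lam) (c12 t lam) (c21 t lam) / lam) 0 := by
      simp only [gaugeNum, div_eq_mul_inv]
      fun_prop
    have hLc : ContinuousAt (fun t => gaugeLower (pquant r s c12 c21 t) (r t) (s t) lam
        (c11 t lam) (c12 t lam) (c21 t lam)) 0 := by
      simp only [gaugeLower, div_eq_mul_inv]
      fun_prop
    have hQc : ContinuousAt (fun t => gaugeDiag (r t) (s t) lam
        (c11 t lam) (c12 t lam) (c21 t lam)) 0 := by
      simp only [gaugeDiag, div_eq_mul_inv]
      fun_prop
    have hMc : ContinuousAt (fun t =>
        !![-gaugeDiag (r t) (s t) lam (c11 t lam) (c12 t lam) (c21 t lam),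
          gaugeNum (pquant r s c12 c21 t) (r t) (s t) lam
            (c11 t lam) (c12 t lam) (c21 t lam) / lam;
          gaugeLower (pquant r s c12 c21 t) (r t) (s t) lam (c11 t lam) (c12 t lam) (c21 t lam),
          gaugeDiag (r t) (s t) lam (c11 t lam) (c12 t lam) (c21 t lam)]) 0 := by
      refine continuousAt_pi.mpr fun i => continuousAt_pi.mpr fun j => ?_
      fin_cases i <;> fin_cases j
      exacts [hQc.neg, hNc, hLc, hQc]
    have hM0 := hMc.tendsto.mono_left (nhdsWithin_le_nhds (s := {t : ℝ | t ≠ 0}))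
    have hval : !![-gaugeDiag (r 0) (s 0) lam (c11 0 lam) (c12 0 lam) (c21 0 lam),
          gaugeNum (pquant r s c12 c21 0) (r 0) (s 0) lam
            (c11 0 lam) (c12 0 lam) (c21 0 lam) / lam;
          gaugeLower (pquant r s c12 c21 0) (r 0) (s 0) lam (c11 0 lam) (c12 0 lam) (c21 0 lam),
          gaugeDiag (r 0) (s 0) lam (c11 0 lam) (c12 0 lam) (c21 0 lam)] = 0 := by
      simp only [gaugeDiag, gaugeNum, gaugeLower, hq0, hp0]
      ext i j
      fin_cases i <;> fin_cases j <;> simp [hs0]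
    rw [hval] at hM0
    refine hM0.congr' ?_
    filter_upwards [self_mem_nhdsWithin, mem_nhdsWithin_of_mem_nhds hnhds] with t ht0 ht
    exact (gaugeGen_eq r s c11 c12 c21 ht0 hlam.1 hlam.2 (hrs t ht).1 (hrs t ht).2).symm
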